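/- arXiv:1309.0124 — 2 statements merged into one kernel-verified Lean document; each statement's English description precedes it below -/
import Mathlib

section
/- For every Dyck word w with n x's and every integer k, the normal order coefficient S_w(k) equals the graph Stirling number {G_w brace k}. -/
/-- `graphStirling G k` is the number of partitions of the vertex set of `G` into `k`
non-empty independent sets. -/
noncomputable def graphStirling {V : Type*} (G : SimpleGraph V) (k : ℕ) : ℕ :=
  Nat.card {P : Finset (Finset V) // P.card = k ∧ (∀ p ∈ P, p.Nonempty) ∧
    (∀ v : V, ∃! p, p ∈ P ∧ v ∈ p) ∧ ∀ p ∈ P, ∀ u ∈ p, ∀ v ∈ p, ¬ G.Adj u v}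
/-- The graph obtained from `G` by adding a dominating vertex (a new vertex adjacent to all
the vertices of `G`). -/
def addDom {V : Type} (G : SimpleGraph V) : SimpleGraph (Option V) :=
  SimpleGraph.fromRel (fun a b =>
    (∃ u v : V, a = some u ∧ b = some v ∧ G.Adj u v) ∨ a = none)

/-- The disjoint union of two graphs. -/
def disjUnion {V W : Type} (G : SimpleGraph V) (H : SimpleGraph W) : SimpleGraph (V ⊕ W) :=
  SimpleGraph.fromRel (fun a b =>
    (∃ u v : V, a = Sum.inl u ∧ b = Sum.inl v ∧ G.Adj u v) ∨
    (∃ u v : W, a = Sum.inr u ∧ b = Sum.inr v ∧ H.Adj u v))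

/-- Quasi-threshold graphs: the smallest class of graphs (closed under isomorphism) containing
`K_1` and closed under adding a dominating vertex and under disjoint union. -/
inductive IsQuasiThreshold : {V : Type} → SimpleGraph V → Prop where
  | single : IsQuasiThreshold (⊥ : SimpleGraph PUnit)
  | addDominating {V : Type} {G : SimpleGraph V} :
      IsQuasiThreshold G → IsQuasiThreshold (addDom G)
  | union {V W : Type} {G : SimpleGraph V} {H : SimpleGraph W} :
      IsQuasiThreshold G → IsQuasiThreshold H → IsQuasiThreshold (disjUnion G H)
  | iso {V W : Type} {G : SimpleGraph V} {H : SimpleGraph W} :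
      IsQuasiThreshold G → G ≃g H → IsQuasiThreshold H
/-- `WordGraph w V G` asserts that `G` (on vertex set `V`) is the quasi-threshold graph `G_w`
associated with the Dyck word `w`: `G_{xD} = K_1`; `G_{x w' D} = G_{w'}` plus a dominating
vertex; and the graph of a concatenation of non-empty Dyck words is the disjoint union of
their graphs. -/
inductive WordGraph : List Bool → (V : Type) → SimpleGraph V → Prop where
  | k1 : WordGraph [true, false] PUnit ⊥
  | dom {w : List Bool} {V : Type} {G : SimpleGraph V} :
      WordGraph w V G → WordGraph ([true] ++ w ++ [false]) (Option V) (addDom G)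
  | union {w₁ w₂ : List Bool} {V₁ V₂ : Type} {G₁ : SimpleGraph V₁} {G₂ : SimpleGraph V₂} :
      w₁ ≠ [] → w₂ ≠ [] → WordGraph w₁ V₁ G₁ → WordGraph w₂ V₂ G₂ →
      WordGraph (w₁ ++ w₂) (V₁ ⊕ V₂) (disjUnion G₁ G₂)
/-- A word in the symbols `x` (here `true`) and `D` (here `false`) is a Dyck word if it has
equally many `x`'s and `D`'s and every prefix has at least as many `x`'s as `D`'s. -/
def IsDyck (w : List Bool) : Prop :=
  w.count true = w.count false ∧
    ∀ p : ℕ, (w.take p).count false ≤ (w.take p).count true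

/-- The operator of multiplication by `X` on `ℝ[X]`. -/
noncomputable def xOp : Polynomial ℝ →ₗ[ℝ] Polynomial ℝ := LinearMap.mulLeft ℝ Polynomial.X

/-- The derivative operator on `ℝ[X]`. -/
noncomputable def dOp : Polynomial ℝ →ₗ[ℝ] Polynomial ℝ := Polynomial.derivative

/-- The operator on `ℝ[X]` represented by a word in `x` and `D`, read left to right (so the
leftmost symbol is the outermost operator). -/
noncomputable def wordOp : List Bool → (Polynomial ℝ →ₗ[ℝ] Polynomial ℝ)
  | [] => LinearMap.id
  | b :: w => (if b then xOp else dOp) ∘ₗ wordOp w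

/-- The operator `x^k D^k` on `ℝ[X]` (interpreted as `0` for negative `k`). -/
noncomputable def xkDk (k : ℤ) : Polynomial ℝ →ₗ[ℝ] Polynomial ℝ :=
  if 0 ≤ k then (xOp ^ k.toNat) ∘ₗ (dOp ^ k.toNat) else 0

/-- `S : ℤ → ℝ` is the (finitely supported) sequence of normal order coefficients of the
word `w`, i.e. `w = Σ_k S k • x^k D^k` as operators on `ℝ[X]`, with `S k = 0` for `k < 0`. -/
def IsNormalOrder (w : List Bool) (S : ℤ → ℝ) : Prop :=
  (Function.support S).Finite ∧ (∀ k : ℤ, k < 0 → S k = 0) ∧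
    wordOp w = ∑ᶠ k : ℤ, S k • xkDk k

open Polynomial in
lemma dOp_pow_X_pow (k m : ℕ) :
    (dOp ^ k) (X ^ m : ℝ[X]) = (m.descFactorial k : ℝ) • X ^ (m - k) := by
  rw [dOp, Module.End.coe_pow, iterate_derivative_X_pow_eq_smul]

open Polynomial in
lemma xOp_pow_apply (k : ℕ) (p : ℝ[X]) : (xOp ^ k) p = X ^ k * p := by
  rw [xOp, LinearMap.pow_mulLeft, LinearMap.mulLeft_apply]

open Polynomial in
lemma xkDk_natCast_X_pow (k m : ℕ) :
    xkDk k (X ^ m) = (m.descFactorial k : ℝ) • X ^ m := by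
  rw [xkDk, if_pos (Int.natCast_nonneg k), Int.toNat_natCast, LinearMap.comp_apply,
    dOp_pow_X_pow, map_smul, xOp_pow_apply, ← pow_add]
  rcases le_or_gt k m with h | h
  · rw [Nat.add_sub_cancel' h]
  · simp [Nat.descFactorial_of_lt h]

lemma wordOp_append (u v : List Bool) : wordOp (u ++ v) = wordOp u ∘ₗ wordOp v := by
  induction u with
  | nil => rfl
  | cons b u ih => simp [wordOp, ih, LinearMap.comp_assoc]

lemma addDom_some_some {V : Type} (G : SimpleGraph V) (u v : V) :
    (addDom G).Adj (some u) (some v) ↔ G.Adj u v := by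
  simpa [addDom, G.adj_comm v u] using G.ne_of_adj

lemma addDom_none_some {V : Type} (G : SimpleGraph V) (v : V) :
    (addDom G).Adj none (some v) := by
  simp [addDom]

lemma disjUnion_inl_inl {V W : Type} (G : SimpleGraph V) (H : SimpleGraph W) (u v : V) :
    (disjUnion G H).Adj (.inl u) (.inl v) ↔ G.Adj u v := by
  simpa [disjUnion, G.adj_comm v u] using G.ne_of_adj

lemma disjUnion_inr_inr {V W : Type} (G : SimpleGraph V) (H : SimpleGraph W) (u v : W) :
    (disjUnion G H).Adj (.inr u) (.inr v) ↔ H.Adj u v := by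
  simpa [disjUnion, H.adj_comm v u] using H.ne_of_adj

lemma disjUnion_inl_inr {V W : Type} (G : SimpleGraph V) (H : SimpleGraph W) (u : V) (v : W) :
    ¬ (disjUnion G H).Adj (.inl u) (.inr v) := by
  simp [disjUnion]

/-- A coloring of `addDom G` is a color for the dominating vertex together with a coloring of `G`
by the remaining colors. -/
def addDomColoringEquiv {V : Type} (G : SimpleGraph V) (α : Type) :
    (addDom G).Coloring α ≃ Σ a : α, G.Coloring {b : α // b ≠ a} where
  toFun c := ⟨c none, .mk (fun v => ⟨c (some v), (c.valid (addDom_none_some G v)).symm⟩)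
    fun h => by simpa using c.valid ((addDom_some_some G _ _).2 h)⟩
  invFun c := .mk (fun o => o.elim c.1 fun v => (c.2 v).1) fun {u v} h => by
    rcases u with _ | u <;> rcases v with _ | v
    · exact (h.ne rfl).elim
    · exact (c.2 v).2.symm
    · exact (c.2 u).2
    · exact Subtype.coe_injective.ne (c.2.valid ((addDom_some_some G u v).1 h))
  left_inv c := by
    ext o
    cases o <;> rfl
  right_inv _ := rfl

/-- A coloring of a disjoint union is a pair of colorings. -/
def disjUnionColoringEquiv {V W : Type} (G : SimpleGraph V) (H : SimpleGraph W) (α : Type) :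
    (disjUnion G H).Coloring α ≃ G.Coloring α × H.Coloring α where
  toFun c := (.mk (fun v => c (.inl v)) fun h => c.valid ((disjUnion_inl_inl G H _ _).2 h),
    .mk (fun v => c (.inr v)) fun h => c.valid ((disjUnion_inr_inr G H _ _).2 h))
  invFun c := .mk (Sum.elim c.1 c.2) fun {u v} h => by
    rcases u with u | u <;> rcases v with v | v
    · exact c.1.valid ((disjUnion_inl_inl G H u v).1 h)
    · exact (disjUnion_inl_inr G H u v h).elim
    · exact (disjUnion_inl_inr G H v u h.symm).elim
    · exact c.2.valid ((disjUnion_inr_inr G H u v).1 h)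
  left_inv c := by
    ext o
    cases o <;> rfl
  right_inv _ := rfl

lemma WordGraph.finite {w : List Bool} {V : Type} {G : SimpleGraph V} (h : WordGraph w V G) :
    Finite V := by
  induction h with
  | k1 => infer_instance
  | dom _ _ => infer_instance
  | union _ _ _ _ _ _ => infer_instance

instance finite_coloring {V α : Type} [Finite V] [Finite α] (G : SimpleGraph V) :
    Finite (G.Coloring α) :=
  DFunLike.finite _

open Polynomial in
/-- The operator of a word acts on `X ^ m` by the number of proper `m`-colorings of its graph. -/
lemma WordGraph.wordOp_X_pow {w : List Bool} {V : Type} {G : SimpleGraph V} (h : WordGraph w V G)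
    (α : Type) [Fintype α] :
    wordOp w (X ^ Fintype.card α) = (Nat.card (G.Coloring α) : ℝ) • X ^ Fintype.card α := by
  induction h generalizing α with
  | k1 =>
    have e : (⊥ : SimpleGraph PUnit).Coloring α ≃ α :=
      { toFun := fun c => c ⟨⟩
        invFun := fun a => .mk (fun _ => a) fun h => h.elim
        left_inv := fun _ => rfl
        right_inv := fun _ => rfl }
    have h := xkDk_natCast_X_pow 1 (Fintype.card α)
    rw [Nat.card_congr e, Nat.card_eq_fintype_card]
    simpa [xkDk, wordOp] using h
  | @dom w V G hG ih =>
    classical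
    have := hG.finite
    have key (a : α) : (Nat.card (G.Coloring {b : α // b ≠ a}) : ℝ) • (X : ℝ[X]) ^ Fintype.card α =
        xOp (wordOp w (X ^ (Fintype.card α - 1))) := by
      have h := ih {b : α // b ≠ a}
      have hc : 0 < Fintype.card α := Fintype.card_pos_iff.2 ⟨a⟩
      rw [Fintype.card_subtype_compl, Fintype.card_subtype_eq] at h
      rw [h, map_smul, xOp, LinearMap.mulLeft_apply, ← pow_succ', Nat.sub_add_cancel hc]
    have hd : dOp ((X : ℝ[X]) ^ Fintype.card α) =
        (Fintype.card α : ℝ) • X ^ (Fintype.card α - 1) := by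
      simpa using dOp_pow_X_pow 1 (Fintype.card α)
    rw [Nat.card_congr (addDomColoringEquiv G α), Nat.card_sigma, Nat.cast_sum, Finset.sum_smul,
      Finset.sum_congr rfl fun a _ => key a]
    simp only [wordOp_append, wordOp, List.cons_append, if_true, LinearMap.comp_apply,
      LinearMap.id_apply, Bool.false_eq_true, if_false, hd, Finset.sum_const, Finset.card_univ,
      Nat.cast_smul_eq_nsmul, map_nsmul, List.nil_append]
  | @union w₁ w₂ V₁ V₂ G₁ G₂ _ _ _ _ ih₁ ih₂ =>
    rw [Nat.card_congr (disjUnionColoringEquiv G₁ G₂ α), Nat.card_prod, wordOp_append,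
      LinearMap.comp_apply, ih₂, map_smul, ih₁, smul_smul, Nat.cast_mul, mul_comm]

/-- `P` is a partition of the vertex set of `G` into non-empty independent sets. -/
def IsIndepPartition {V : Type*} (G : SimpleGraph V) (P : Finset (Finset V)) : Prop :=
  (∀ p ∈ P, p.Nonempty) ∧ (∀ v : V, ∃! p, p ∈ P ∧ v ∈ p) ∧
    ∀ p ∈ P, ∀ u ∈ p, ∀ v ∈ p, ¬ G.Adj u v

namespace IsIndepPartition

variable {V : Type*} {G : SimpleGraph V} {P : Finset (Finset V)}

/-- The block of an independent partition containing a given vertex. -/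
noncomputable def block (h : IsIndepPartition G P) (v : V) : P :=
  ⟨(h.2.1 v).choose, (h.2.1 v).choose_spec.1.1⟩

lemma mem_block (h : IsIndepPartition G P) (v : V) : v ∈ (h.block v).1 :=
  (h.2.1 v).choose_spec.1.2

lemma block_eq (h : IsIndepPartition G P) {v : V} (p : P) (hv : v ∈ p.1) : h.block v = p :=
  Subtype.ext ((h.2.1 v).unique ⟨(h.block v).2, h.mem_block v⟩ ⟨p.2, hv⟩)

/-- The coloring obtained by assigning distinct colors to the blocks. -/
noncomputable def coloring {α : Type*} (h : IsIndepPartition G P) (f : P ↪ α) : G.Coloring α :=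
  .mk (fun v => f (h.block v)) fun {u v} huv heq =>
    h.2.2 _ (h.block v).2 u (f.injective heq ▸ h.mem_block u) v (h.mem_block v) huv

lemma coloring_apply {α : Type*} (h : IsIndepPartition G P) (f : P ↪ α) (v : V) :
    h.coloring f v = f (h.block v) := rfl

lemma mem_iff_coloring {α : Type*} [Fintype V] [DecidableEq α] (h : IsIndepPartition G P)
    (f : P ↪ α) (p : Finset V) :
    p ∈ P ↔ ∃ v, p = ({u | h.coloring f u = h.coloring f v} : Finset V) := by
  have key (v : V) : (h.block v).1 = ({u | h.coloring f u = h.coloring f v} : Finset V) := by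
    ext u
    rw [Finset.mem_filter_univ, coloring_apply, coloring_apply, f.injective.eq_iff]
    exact ⟨fun hu => h.block_eq _ hu, fun hu => hu ▸ h.mem_block u⟩
  constructor
  · intro hp
    obtain ⟨v, hv⟩ := h.1 p hp
    exact ⟨v, by rw [← key, h.block_eq ⟨p, hp⟩ hv]⟩
  · rintro ⟨v, rfl⟩
    rw [← key]
    exact (h.block v).2

end IsIndepPartition

lemma coloring_bijective {V α : Type*} [Fintype V] (G : SimpleGraph V) :
    Function.Bijective fun x : Σ P : {P // IsIndepPartition G P}, (P.1 ↪ α) =>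
      x.1.2.coloring x.2 := by
  classical
  constructor
  · rintro ⟨⟨P, hP⟩, f⟩ ⟨⟨Q, hQ⟩, g⟩ h
    replace h : hP.coloring f = hQ.coloring g := h
    obtain rfl : P = Q := by
      ext p
      rw [hP.mem_iff_coloring f, hQ.mem_iff_coloring g, h]
    congr
    ext p
    obtain ⟨v, hv⟩ := hP.1 p p.2
    have := DFunLike.congr_fun h v
    rwa [hP.coloring_apply, hQ.coloring_apply, hP.block_eq p hv] at this
  · intro c
    let fiber (v : V) : Finset V := {u | c u = c v}
    have mem_fiber (u v : V) : u ∈ fiber v ↔ c u = c v := Finset.mem_filter_univ u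
    let P : Finset (Finset V) := Finset.univ.image fiber
    have mem_P (p : Finset V) : p ∈ P ↔ ∃ v, fiber v = p := by simp [P]
    have hP : IsIndepPartition G P := by
      refine ⟨fun p hp => ?_, fun v => ⟨fiber v, ⟨(mem_P _).2 ⟨v, rfl⟩, (mem_fiber v v).2 rfl⟩, ?_⟩,
        fun p hp u hu v hv huv => ?_⟩
      · obtain ⟨v, rfl⟩ := (mem_P p).1 hp
        exact ⟨v, (mem_fiber v v).2 rfl⟩
      · rintro p ⟨hp, hv⟩
        obtain ⟨w, rfl⟩ := (mem_P p).1 hp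
        ext u
        rw [mem_fiber, mem_fiber, (mem_fiber v w).1 hv]
      · obtain ⟨w, rfl⟩ := (mem_P p).1 hp
        exact c.valid huv (((mem_fiber u w).1 hu).trans ((mem_fiber v w).1 hv).symm)
    choose r hr using fun p : P => (mem_P p.1).1 p.2
    let f : P ↪ α := ⟨fun p => c (r p), fun p q hpq => Subtype.ext <| by
      rw [← hr p, ← hr q]
      ext u
      rw [mem_fiber, mem_fiber, show c (r p) = c (r q) from hpq]⟩
    refine ⟨⟨⟨P, hP⟩, f⟩, ?_⟩
    ext v
    change c (r (hP.block v)) = c v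
    have := hP.mem_block v
    rw [← hr, mem_fiber] at this
    exact this.symm

/-- The number of proper `m`-colorings in terms of graph Stirling numbers. -/
lemma card_coloring_eq_sum {V : Type*} [Fintype V] (G : SimpleGraph V) (m : ℕ) :
    Nat.card (G.Coloring (Fin m)) =
      ∑ k ∈ Finset.range (m + 1), graphStirling G k * m.descFactorial k := by
  classical
  have hcard (k : ℕ) : graphStirling G k =
      ((Finset.univ : Finset {P // IsIndepPartition G P}).filter (·.1.card = k)).card := by
    rw [graphStirling, ← Fintype.card_subtype, ← Nat.card_eq_fintype_card]
    exact Nat.card_congr (((Equiv.subtypeSubtypeEquivSubtypeInter _ _).trans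
      (Equiv.subtypeEquivRight fun P => and_comm)).symm)
  rw [← Nat.card_congr (Equiv.ofBijective _ (coloring_bijective G)), Nat.card_sigma]
  simp only [Nat.card_eq_fintype_card, Fintype.card_embedding_eq, Fintype.card_fin,
    Fintype.card_coe, hcard, Finset.card_eq_sum_ones, Finset.sum_mul, one_mul]
  simp only [Finset.sum_filter]
  rw [Finset.sum_comm]
  refine Finset.sum_congr rfl fun P _ => ?_
  rw [Finset.sum_ite_eq]
  split_ifs with h
  · rfl
  · exact Nat.descFactorial_of_lt (by simpa [Nat.lt_succ_iff] using h)

open Polynomial in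
lemma IsNormalOrder.wordOp_X_pow {w : List Bool} {S : ℤ → ℝ} (hS : IsNormalOrder w S) (m : ℕ) :
    wordOp w (X ^ m) =
      (∑ k ∈ Finset.range (m + 1), S k * (m.descFactorial k : ℝ)) • X ^ m := by
  classical
  obtain ⟨hfin, hneg, heq⟩ := hS
  set A := (Finset.range (m + 1)).image ((↑) : ℕ → ℤ) with hA
  rw [heq, finsum_eq_sum_of_support_subset (s := hfin.toFinset ∪ A), LinearMap.sum_apply,
    ← Finset.sum_subset Finset.subset_union_right, hA, Finset.sum_image Nat.cast_injective.injOn,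
    Finset.sum_smul]
  · simp [xkDk_natCast_X_pow, smul_smul]
  · intro k _ hk
    rcases lt_or_ge k 0 with h | h
    · simp [hneg k h]
    · lift k to ℕ using h
      have : m < k := by simpa [hA] using hk
      simp [xkDk_natCast_X_pow, Nat.descFactorial_of_lt this]
  · intro k hk
    have : S k ≠ 0 := fun h => hk (by simp [h])
    simp [this]

lemma eq_of_sum_mul_descFactorial_eq {R : Type*} [CommRing R] [IsDomain R] [CharZero R]
    {a b : ℕ → R} (h : ∀ m, ∑ k ∈ Finset.range (m + 1), a k * (m.descFactorial k : R) =
      ∑ k ∈ Finset.range (m + 1), b k * (m.descFactorial k : R)) : a = b := by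
  ext m
  induction m using Nat.strong_induction_on with
  | _ m ih =>
    have hm := h m
    rw [Finset.sum_range_succ, Finset.sum_range_succ,
      Finset.sum_congr rfl fun k hk => by rw [ih k (Finset.mem_range.1 hk)]] at hm
    refine mul_right_cancel₀ ?_ (add_left_cancel hm)
    rw [Nat.descFactorial_self]
    exact_mod_cast m.factorial_ne_zero

/-- For every Dyck word `w` and integer `k`, the normal order coefficient `S_w(k)` equals the
graph Stirling number of the quasi-threshold graph `G_w` associated with `w`. -/
theorem normalOrder_eq_graphStirling_of_wordGraph
    (w : List Bool) (hw : IsDyck w) (V : Type) [Fintype V] (G : SimpleGraph V)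
    (hG : WordGraph w V G) (S : ℤ → ℝ) (hS : IsNormalOrder w S) (k : ℤ) :
    S k = if 0 ≤ k then (graphStirling G k.toNat : ℝ) else 0 := by
  split_ifs with hk
  · lift k to ℕ using hk
    refine congrFun (eq_of_sum_mul_descFactorial_eq (a := fun k : ℕ => S k)
      (b := fun k => (graphStirling G k : ℝ)) fun m => ?_) k
    have h := hG.wordOp_X_pow (Fin m)
    rw [Fintype.card_fin, hS.wordOp_X_pow, card_coloring_eq_sum] at h
    exact_mod_cast smul_left_injective ℝ (pow_ne_zero m Polynomial.X_ne_zero) h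
  · exact hS.2.1 k (not_le.1 hk)
end

section
/- For every Dyck word w with n x's and every integer k, the normal order coefficient S_w(k) equals m_{n−k}(Γ_w), the number of matchings of size n−k in the bipartite graph Γ_w. -/
/-- `xsBefore w i` is the number of `x`'s (`true`s) occurring before the `i`-th `D` (`false`)
in the word `w` (1-indexed); if `w` has fewer than `i` `D`'s it is the total number of `x`'s. -/
def xsBefore : List Bool → ℕ → ℕ
  | [], _ => 0
  | _ :: _, 0 => 0
  | true :: w, i + 1 => xsBefore w (i + 1) + 1
  | false :: w, i + 1 => if i = 0 then 0 else xsBefore w i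

/-- The Ferrers board `B_w`: the set of (labels of) unit squares lying above the Dyck path of
`w` and inside the box `[0,n] × [0,n]`, where the unit square with top-right corner `(i,j)` is
labelled `(i,j)`.  The square `(i,j)` lies above the path exactly when the `i`-th `D` of `w`
occurs before the `j`-th `x`, i.e. when `xsBefore w i < j`. -/
def ferrersBoard (w : List Bool) : Finset (ℕ × ℕ) :=
  ((Finset.Icc 1 (w.count true)) ×ˢ (Finset.Icc 1 (w.count true))).filter
    (fun p => xsBefore w p.1 < p.2)

/-- `rookCount B k` is the number of placements of `k` non-attacking rooks on the board `B`:
`k`-element subsets of `B` with no two elements sharing a first coordinate and no two sharing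
a second coordinate. -/
noncomputable def rookCount (B : Finset (ℕ × ℕ)) (k : ℕ) : ℕ :=
  Nat.card {s : Finset (ℕ × ℕ) // s ⊆ B ∧ s.card = k ∧
    ∀ p ∈ s, ∀ q ∈ s, p ≠ q → p.1 ≠ q.1 ∧ p.2 ≠ q.2}

/-- The clique-union graph `H_w` on vertex set `{1, …, n}` (encoded as `Fin n`, vertex `i`
having label `i+1`): labels `i < j` are adjacent iff the unit square labelled `(i,j)` lies
below the Dyck path of `w` and completely above the line `x = y`, i.e. iff the `j`-th `x`
occurs before the `i`-th `D`, i.e. iff `j ≤ xsBefore w i`. -/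
def cliqueUnionGraph (w : List Bool) : SimpleGraph (Fin (w.count true)) :=
  SimpleGraph.fromRel (fun i j => (i : ℕ) < (j : ℕ) ∧ (j : ℕ) + 1 ≤ xsBefore w ((i : ℕ) + 1))

/-- The bipartite graph `Γ_w` with partition classes `X = {x_1, …, x_n}` (the `inl` vertices)
and `Y = {y_1, …, y_n}` (the `inr` vertices), with an edge from `x_i` to `y_j` iff
`(i,j) ∈ B_w`. -/
def bipGraph (w : List Bool) : SimpleGraph (Fin (w.count true) ⊕ Fin (w.count true)) :=
  SimpleGraph.fromRel (fun a b => ∃ i j : Fin (w.count true),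
    a = Sum.inl i ∧ b = Sum.inr j ∧ xsBefore w ((i : ℕ) + 1) < (j : ℕ) + 1)

/-- `matchCount G k` is the number of matchings of size `k` in `G`: sets of `k` edges of `G`,
pairwise sharing no endvertex. -/
noncomputable def matchCount {V : Type*} (G : SimpleGraph V) (k : ℕ) : ℕ :=
  Nat.card {s : Finset (Sym2 V) // s.card = k ∧ (∀ e ∈ s, e ∈ G.edgeSet) ∧
    ∀ e ∈ s, ∀ f ∈ s, e ≠ f → ∀ v : V, v ∈ e → v ∉ f}

/-- The matching number of `G`: the size of a largest matching. -/
noncomputable def matchNumber {V : Type*} (G : SimpleGraph V) : ℕ :=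
  sSup {k : ℕ | 0 < matchCount G k}

/-- No two squares of `s` share a row or a column. -/
def IsNonAttacking (s : Finset (ℕ × ℕ)) : Prop :=
  ∀ p ∈ s, ∀ q ∈ s, p ≠ q → p.1 ≠ q.1 ∧ p.2 ≠ q.2

open Classical in
/-- The placements of `r` non-attacking rooks on the board `B`. -/
noncomputable def rookPlacements (B : Finset (ℕ × ℕ)) (r : ℕ) : Finset (Finset (ℕ × ℕ)) :=
  (B.powersetCard r).filter IsNonAttacking

theorem mem_rookPlacements {B : Finset (ℕ × ℕ)} {r : ℕ} {s : Finset (ℕ × ℕ)} :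
    s ∈ rookPlacements B r ↔ (s ⊆ B ∧ s.card = r) ∧ IsNonAttacking s := by
  simp [rookPlacements, Finset.mem_powersetCard]

/-- The board of a word, with rows (the `D`'s) and columns (the `x`'s) numbered from `0`
starting at the end of the word. -/
def revBoard : List Bool → Finset (ℕ × ℕ)
  | [] => ∅
  | true :: w => revBoard w
  | false :: w => revBoard w ∪ {w.count false} ×ˢ Finset.range (w.count true)

theorem revBoard_subset (w : List Bool) :
    revBoard w ⊆ Finset.range (w.count false) ×ˢ Finset.range (w.count true) := by
  induction w with
  | nil => simp [revBoard]
  | cons c w ih =>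
    intro p hp
    cases c
    · simp only [revBoard, Finset.mem_union, Finset.mem_product, Finset.mem_singleton,
        Finset.mem_range] at hp
      have := @ih p
      simp only [Finset.mem_product, Finset.mem_range] at this
      simp only [Finset.mem_product, Finset.mem_range, List.count_cons]
      simp
      grind
    · have := ih (show p ∈ revBoard w from hp)
      simp only [Finset.mem_product, Finset.mem_range, List.count_cons] at this ⊢
      simp
      omega

theorem mem_revBoard_iff (w : List Bool) (i j : ℕ) (hi : i < w.count false)
    (hj : j < w.count true) :
    (w.count false - 1 - i, w.count true - 1 - j) ∈ revBoard w ↔ xsBefore w (i + 1) < j + 1 := by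
  induction w generalizing i j with
  | nil => simp at hi
  | cons c w ih =>
    have hsub := revBoard_subset w
    cases c
    · simp only [List.count_cons, beq_self_eq_true, if_true] at hi hj
      simp at hj
      simp only [revBoard, xsBefore, Finset.mem_union, Finset.mem_product, Finset.mem_singleton,
        Finset.mem_range, List.count_cons]
      rcases i with _ | i
      · simp; omega
      · have h := ih i j (by omega) hj
        simp
        rw [← Nat.lt_succ_iff, ← h]
        have e : w.count false - (i + 1) = w.count false - 1 - i := by omega
        rw [e]
        constructor
        · rintro (h | h)
          · exact h
          · omega
        · exact Or.inl
    · simp only [List.count_cons, beq_self_eq_true, if_true] at hi hj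
      simp at hi
      simp only [revBoard, xsBefore, List.count_cons]
      rcases j with _ | j
      · simp
        intro h
        have := hsub h
        simp at this
      · have h := ih i j hi (by omega)
        simp
        rw [← Nat.lt_succ_iff, ← h]
        have e : w.count true - (j + 1) = w.count true - 1 - j := by omega
        rw [e]

theorem rookPlacements_zero (B : Finset (ℕ × ℕ)) : rookPlacements B 0 = {∅} := by
  ext s
  rw [mem_rookPlacements, Finset.mem_singleton, Finset.card_eq_zero]
  constructor
  · exact fun h => h.1.2
  · rintro rfl
    exact ⟨⟨Finset.empty_subset _, rfl⟩, by simp [IsNonAttacking]⟩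

theorem IsNonAttacking.mono {s t : Finset (ℕ × ℕ)} (hs : IsNonAttacking s) (h : t ⊆ s) :
    IsNonAttacking t :=
  fun p hp q hq => hs p (h hp) q (h hq)

theorem IsNonAttacking.card_image_fst {s : Finset (ℕ × ℕ)} (hs : IsNonAttacking s) :
    (s.image Prod.fst).card = s.card :=
  Finset.card_image_of_injOn fun p hp q hq h => by
    by_contra hne
    exact (hs p hp q hq hne).1 h

theorem IsNonAttacking.card_image_snd {s : Finset (ℕ × ℕ)} (hs : IsNonAttacking s) :
    (s.image Prod.snd).card = s.card :=
  Finset.card_image_of_injOn fun p hp q hq h => by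
    by_contra hne
    exact (hs p hp q hq hne).2 h

/-- Adding a full row to a board. -/
theorem card_rookPlacements_union_row {B : Finset (ℕ × ℕ)} {a b : ℕ}
    (hB : B ⊆ Finset.range b ×ˢ Finset.range a) (r : ℕ) :
    (rookPlacements (B ∪ {b} ×ˢ Finset.range a) (r + 1)).card =
      (rookPlacements B (r + 1)).card + (a - r) * (rookPlacements B r).card := by
  classical
  have hBb : ∀ p ∈ B, p.1 < b ∧ p.2 < a := fun p hp => by simpa using hB hp
  rw [← Finset.card_filter_add_card_filter_not (fun s => ∀ p ∈ s, p.1 ≠ b)]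
  congr 1
  · congr 1
    ext s
    simp only [Finset.mem_filter, mem_rookPlacements]
    constructor
    · rintro ⟨⟨⟨h1, h2⟩, h3⟩, h4⟩
      refine ⟨⟨fun p hp => ?_, h2⟩, h3⟩
      have h5 := h1 hp
      have h6 := h4 p hp
      simp only [Finset.mem_union, Finset.mem_product, Finset.mem_singleton] at h5
      tauto
    · rintro ⟨⟨h1, h2⟩, h3⟩
      exact ⟨⟨⟨h1.trans Finset.subset_union_left, h2⟩, h3⟩, fun p hp => (hBb p (h1 hp)).1.ne⟩
  · have hcard : ((rookPlacements B r).sigma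
        fun t => Finset.range a \ t.image Prod.snd).card =
        (a - r) * (rookPlacements B r).card := by
      rw [Finset.card_sigma, Finset.sum_const_nat (m := a - r), mul_comm]
      intro t ht
      rw [mem_rookPlacements] at ht
      rw [Finset.card_sdiff_of_subset, ht.2.card_image_snd, ht.1.2, Finset.card_range]
      intro j hj
      obtain ⟨p, hp, rfl⟩ := Finset.mem_image.1 hj
      exact Finset.mem_range.2 (hBb p (ht.1.1 hp)).2
    rw [← hcard]
    symm
    refine Finset.card_bij (fun x _ => insert (b, x.2) x.1) ?_ ?_ ?_
    · rintro ⟨t, j⟩ h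
      simp only [Finset.mem_sigma, mem_rookPlacements, Finset.mem_sdiff, Finset.mem_range,
        Finset.mem_image, not_exists, not_and] at h
      obtain ⟨⟨⟨h1, h2⟩, h3⟩, h4, h5⟩ := h
      have hbt : ∀ p ∈ t, p.1 ≠ b := fun p hp => (hBb p (h1 hp)).1.ne
      simp only [Finset.mem_filter, mem_rookPlacements]
      refine ⟨⟨⟨?_, ?_⟩, ?_⟩, ?_⟩
      · refine Finset.insert_subset ?_ (h1.trans Finset.subset_union_left)
        simp [h4]
      · rw [Finset.card_insert_of_notMem (fun h => hbt _ h rfl), h2]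
      · intro p hp q hq hne
        rw [Finset.mem_insert] at hp hq
        rcases hp with rfl | hp <;> rcases hq with rfl | hq
        · exact absurd rfl hne
        · exact ⟨(hbt q hq).symm, fun h => h5 q hq h.symm⟩
        · exact ⟨hbt p hp, h5 p hp⟩
        · exact h3 p hp q hq hne
      · intro h
        exact h (b, j) (Finset.mem_insert_self _ _) rfl
    · rintro ⟨t, j⟩ h ⟨t', j'⟩ h' heq
      simp only [Finset.mem_sigma, mem_rookPlacements] at h h'
      have hbt : ∀ p ∈ t, p.1 ≠ b := fun p hp => (hBb p (h.1.1.1 hp)).1.ne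
      have hbt' : ∀ p ∈ t', p.1 ≠ b := fun p hp => (hBb p (h'.1.1.1 hp)).1.ne
      have hj : j = j' := by
        have : (b, j) ∈ insert (b, j') t' := heq ▸ Finset.mem_insert_self _ _
        rcases Finset.mem_insert.1 this with h | h
        · exact (Prod.mk.inj h).2
        · exact absurd rfl (hbt' _ h)
      subst hj
      have ht : t = t' := by
        rw [← Finset.erase_insert (fun h => hbt _ h rfl : (b, j) ∉ t),
          ← Finset.erase_insert (fun h => hbt' _ h rfl : (b, j) ∉ t')]
        exact congrArg (fun s => Finset.erase s (b, j)) heq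
      rw [ht]
    · intro s hs
      simp only [Finset.mem_filter, mem_rookPlacements, not_forall, not_not] at hs
      obtain ⟨⟨⟨h1, h2⟩, h3⟩, ⟨b', j⟩, hp, rfl⟩ := hs
      refine ⟨⟨s.erase (b', j), j⟩, ?_, Finset.insert_erase hp⟩
      simp only [Finset.mem_sigma, mem_rookPlacements, Finset.mem_sdiff, Finset.mem_range,
        Finset.mem_image, not_exists, not_and]
      refine ⟨⟨⟨fun q hq => ?_, ?_⟩, h3.mono (Finset.erase_subset _ _)⟩, ?_, ?_⟩
      · rw [Finset.mem_erase] at hq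
        have h5 := h1 hq.2
        have h6 := (h3 q hq.2 _ hp hq.1).1
        simp only [Finset.mem_union, Finset.mem_product, Finset.mem_singleton] at h5
        tauto
      · rw [Finset.card_erase_of_mem hp, h2, Nat.add_sub_cancel]
      · have h5 := h1 hp
        simp only [Finset.mem_union, Finset.mem_product, Finset.mem_range] at h5
        rcases h5 with h5 | h5
        · exact (hBb _ h5).2
        · exact h5.2
      · intro q hq
        rw [Finset.mem_erase] at hq
        exact (h3 q hq.2 _ hp hq.1).2

/-- The number of placements of `r` non-attacking rooks on the board of `w`. -/
noncomputable def wordRook (w : List Bool) (r : ℕ) : ℕ := (rookPlacements (revBoard w) r).card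

theorem wordRook_eq_zero {w : List Bool} {r : ℕ}
    (h : w.count false < r ∨ w.count true < r) : wordRook w r = 0 := by
  rw [wordRook, Finset.card_eq_zero, Finset.eq_empty_iff_forall_notMem]
  intro s hs
  rw [mem_rookPlacements] at hs
  obtain ⟨⟨h1, h2⟩, h3⟩ := hs
  have hsub := h1.trans (revBoard_subset w)
  have hfst : (s.image Prod.fst).card ≤ w.count false := by
    rw [← Finset.card_range (w.count false)]
    refine Finset.card_le_card fun i hi => ?_
    obtain ⟨p, hp, rfl⟩ := Finset.mem_image.1 hi
    exact (Finset.mem_product.1 (hsub hp)).1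
  have hsnd : (s.image Prod.snd).card ≤ w.count true := by
    rw [← Finset.card_range (w.count true)]
    refine Finset.card_le_card fun i hi => ?_
    obtain ⟨p, hp, rfl⟩ := Finset.mem_image.1 hi
    exact (Finset.mem_product.1 (hsub hp)).2
  rw [h3.card_image_fst] at hfst
  rw [h3.card_image_snd] at hsnd
  omega

theorem dOp_mul_xOp_pow (m : ℕ) :
    dOp * xOp ^ m = xOp ^ m * dOp + (m : ℝ) • xOp ^ (m - 1) := by
  refine LinearMap.ext fun p => ?_
  have hx : ∀ (j : ℕ) (q : Polynomial ℝ), (xOp ^ j) q = Polynomial.X ^ j * q := by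
    intro j q
    simp [xOp, LinearMap.pow_mulLeft]
  simp only [Module.End.mul_apply, LinearMap.add_apply, LinearMap.smul_apply, hx, dOp,
    Polynomial.derivative_mul, Polynomial.derivative_X_pow, Polynomial.smul_eq_C_mul]
  ring

/-- Normal ordering of an arbitrary word through rook placements. -/
theorem wordOp_eq_sum (w : List Bool) :
    wordOp w = ∑ r ∈ Finset.range (w.count false + 1),
      (wordRook w r : ℝ) • (xOp ^ (w.count true - r) * dOp ^ (w.count false - r)) := by
  induction w with
  | nil =>
    simp [wordOp, wordRook, rookPlacements_zero]
    rfl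
  | cons c w ih =>
    cases c
    · have hop : wordOp (false :: w) = dOp * wordOp w := by simp [wordOp]; rfl
      have h0 : wordRook (false :: w) 0 = wordRook w 0 := by
        simp [wordRook, rookPlacements_zero]
      have hs : ∀ r, wordRook (false :: w) (r + 1) =
          wordRook w (r + 1) + (w.count true - r) * wordRook w r := fun r =>
        card_rookPlacements_union_row (revBoard_subset w) r
      have hD : (false :: w).count false = w.count false + 1 := by simp
      have hX : (false :: w).count true = w.count true := by simp
      have hlast := wordRook_eq_zero (w := w) (r := w.count false + 1) (Or.inl (by omega))
      rw [hop, ih, hD, hX, Finset.mul_sum, Finset.sum_range_succ' _ (w.count false + 1), h0]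
      set a := w.count true
      set b := w.count false
      have key : ∀ r ∈ Finset.range (b + 1),
          dOp * ((wordRook w r : ℝ) • (xOp ^ (a - r) * dOp ^ (b - r))) =
          (wordRook w r : ℝ) • (xOp ^ (a - r) * dOp ^ (b + 1 - r)) +
          (((a - r) * wordRook w r : ℕ) : ℝ) • (xOp ^ (a - (r + 1)) * dOp ^ (b - r)) := by
        intro r hr
        have hr' : b + 1 - r = b - r + 1 := by
          have := Finset.mem_range.1 hr
          omega
        rw [mul_smul_comm, ← mul_assoc, dOp_mul_xOp_pow, add_mul, smul_add, mul_assoc,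
          ← pow_succ', ← hr', smul_mul_assoc, smul_smul, Nat.sub_sub]
        push_cast
        rw [mul_comm (wordRook w r : ℝ)]
      rw [Finset.sum_congr rfl key, Finset.sum_add_distrib]
      have hshift : ∑ r ∈ Finset.range (b + 1),
            (wordRook w r : ℝ) • (xOp ^ (a - r) * dOp ^ (b + 1 - r)) =
          ∑ r ∈ Finset.range (b + 1),
            (wordRook w (r + 1) : ℝ) • (xOp ^ (a - (r + 1)) * dOp ^ (b + 1 - (r + 1))) +
          (wordRook w 0 : ℝ) • (xOp ^ (a - 0) * dOp ^ (b + 1 - 0)) := by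
        rw [← Finset.sum_range_succ' (fun r =>
          (wordRook w r : ℝ) • (xOp ^ (a - r) * dOp ^ (b + 1 - r))),
          Finset.sum_range_succ _ (b + 1), hlast]
        simp
      rw [hshift, add_right_comm, ← Finset.sum_add_distrib]
      congr 1
      refine Finset.sum_congr rfl fun r _ => ?_
      rw [hs, Nat.add_sub_add_right, ← add_smul]
      push_cast
      rfl
    · have hop : wordOp (true :: w) = xOp * wordOp w := by simp [wordOp]; rfl
      have hD : (true :: w).count false = w.count false := by simp
      have hX : (true :: w).count true = w.count true + 1 := by simp
      have hs : ∀ r, wordRook (true :: w) r = wordRook w r := fun r => rfl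
      rw [hop, ih, hD, hX, Finset.mul_sum]
      refine Finset.sum_congr rfl fun r _ => ?_
      rw [hs, mul_smul_comm, ← mul_assoc, ← pow_succ']
      by_cases h : r ≤ w.count true
      · rw [Nat.sub_add_comm h]
      · rw [wordRook_eq_zero (Or.inr (by omega))]
        simp

theorem xOp_pow_mul_dOp_pow_apply_X_pow (k m : ℕ) :
    (xOp ^ k * dOp ^ k) (Polynomial.X ^ m) =
      (m.descFactorial k : ℝ) • (Polynomial.X ^ m : Polynomial ℝ) := by
  have hx : ∀ q : Polynomial ℝ, (xOp ^ k) q = Polynomial.X ^ k * q := by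
    intro q
    simp [xOp, LinearMap.pow_mulLeft]
  rw [Module.End.mul_apply, hx, dOp, Module.End.pow_apply,
    Polynomial.iterate_derivative_X_pow_eq_smul]
  rcases le_or_gt k m with h | h
  · rw [mul_smul_comm, ← pow_add, Nat.add_sub_cancel' h, Nat.cast_smul_eq_nsmul]
  · simp [Nat.descFactorial_of_lt h]

theorem coeff_eq_of_sum_eq {N : ℕ} {c d : ℕ → ℝ}
    (h : ∑ k ∈ Finset.range N, c k • (xOp ^ k * dOp ^ k) =
      ∑ k ∈ Finset.range N, d k • (xOp ^ k * dOp ^ k)) :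
    ∀ m < N, c m = d m := by
  intro m
  induction m using Nat.strong_induction_on with
  | _ m ih =>
    intro hm
    have h1 := congrArg (fun f => (f (Polynomial.X ^ m)).coeff m) h
    simp only [LinearMap.sum_apply, LinearMap.smul_apply, xOp_pow_mul_dOp_pow_apply_X_pow,
      Polynomial.finsetSum_coeff, Polynomial.coeff_smul, Polynomial.coeff_X_pow_self,
      smul_eq_mul, mul_one] at h1
    rw [← sub_eq_zero, ← Finset.sum_sub_distrib, Finset.sum_eq_single m] at h1
    · rw [Nat.descFactorial_self, ← sub_mul] at h1
      have hne : (m.factorial : ℝ) ≠ 0 := by exact_mod_cast m.factorial_ne_zero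
      exact sub_eq_zero.1 ((mul_eq_zero.1 h1).resolve_right hne)
    · intro k hk hkm
      rcases lt_or_gt_of_ne hkm with hlt | hgt
      · rw [ih k hlt (Finset.mem_range.1 hk), sub_self]
      · simp [Nat.descFactorial_of_lt hgt]
    · exact fun hm' => absurd (Finset.mem_range.2 hm) hm'

/-- Counting finite sets contained in the range of an injection. -/
theorem natCard_finset_subtype_map {α β : Type*} (f : α ↪ β) (P : Finset β → Prop)
    (hP : ∀ s, P s → ∀ x ∈ s, x ∈ Set.range f) :
    Nat.card {t : Finset α // P (t.map f)} = Nat.card {s : Finset β // P s} := by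
  refine Nat.card_eq_of_bijective
    (fun t : {t : Finset α // P (t.map f)} => (⟨t.1.map f, t.2⟩ : {s : Finset β // P s})) ⟨?_, ?_⟩
  · intro t t' h
    exact Subtype.ext (Finset.map_injective f (Subtype.ext_iff.1 h))
  · rintro ⟨s, hs⟩
    have hmap : (s.preimage f f.injective.injOn).map f = s := by
      ext x
      simp only [Finset.mem_map, Finset.mem_preimage]
      constructor
      · rintro ⟨a, ha, rfl⟩
        exact ha
      · intro hx
        obtain ⟨a, rfl⟩ := hP s hs x hx
        exact ⟨a, hx, rfl⟩
    exact ⟨⟨s.preimage f f.injective.injOn, hmap.symm ▸ hs⟩, Subtype.ext hmap⟩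

/-- The pair `(i, j)` viewed as the potential edge from `x_i` to `y_j`. -/
def pairEdge (n : ℕ) : Fin n × Fin n ↪ Sym2 (Fin n ⊕ Fin n) where
  toFun p := s(Sum.inl p.1, Sum.inr p.2)
  inj' p q h := by
    simpa [Prod.ext_iff] using h

/-- The pair `(i, j)` viewed as a square, with rows and columns numbered from the end. -/
def pairSquare (n : ℕ) : Fin n × Fin n ↪ ℕ × ℕ where
  toFun p := (n - 1 - p.1, n - 1 - p.2)
  inj' p q h := by
    obtain ⟨i, j⟩ := p
    obtain ⟨i', j'⟩ := q
    simp only [Prod.mk.injEq, Fin.ext_iff] at h ⊢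
    omega

theorem pairEdge_apply {n : ℕ} (p : Fin n × Fin n) :
    pairEdge n p = s(Sum.inl p.1, Sum.inr p.2) := rfl

theorem pairSquare_apply {n : ℕ} (p : Fin n × Fin n) :
    pairSquare n p = (n - 1 - (p.1 : ℕ), n - 1 - (p.2 : ℕ)) := rfl

theorem pairEdge_mem_edgeSet (w : List Bool) (p : Fin (w.count true) × Fin (w.count true)) :
    pairEdge _ p ∈ (bipGraph w).edgeSet ↔ xsBefore w ((p.1 : ℕ) + 1) < (p.2 : ℕ) + 1 := by
  simp [pairEdge_apply, bipGraph]

theorem mem_range_pairEdge {w : List Bool} {e : Sym2 (Fin (w.count true) ⊕ Fin (w.count true))}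
    (he : e ∈ (bipGraph w).edgeSet) : e ∈ Set.range (pairEdge (w.count true)) := by
  induction e with
  | _ u v =>
    rw [SimpleGraph.mem_edgeSet, bipGraph, SimpleGraph.fromRel_adj] at he
    rcases he.2 with ⟨i, j, rfl, rfl, -⟩ | ⟨i, j, rfl, rfl, -⟩
    · exact ⟨(i, j), rfl⟩
    · exact ⟨(i, j), Sym2.eq_swap⟩

theorem pairEdge_disjoint_iff {n : ℕ} (p q : Fin n × Fin n) :
    (∀ v, v ∈ pairEdge n p → v ∉ pairEdge n q) ↔ p.1 ≠ q.1 ∧ p.2 ≠ q.2 := by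
  simp [pairEdge_apply]

theorem pairSquare_coords_ne_iff {n : ℕ} (p q : Fin n × Fin n) :
    ((pairSquare n p).1 ≠ (pairSquare n q).1 ∧ (pairSquare n p).2 ≠ (pairSquare n q).2) ↔
      p.1 ≠ q.1 ∧ p.2 ≠ q.2 := by
  simp only [pairSquare_apply, ne_eq, Fin.ext_iff]
  omega

theorem matchCount_bipGraph (w : List Bool) (hw : w.count true = w.count false) (r : ℕ) :
    matchCount (bipGraph w) r = wordRook w r := by
  have hrook : wordRook w r = Nat.card {s // s ∈ rookPlacements (revBoard w) r} := by
    rw [Nat.card_eq_fintype_card, Fintype.card_coe, wordRook]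
  rw [hrook, matchCount, ← natCard_finset_subtype_map (pairEdge (w.count true)),
    ← natCard_finset_subtype_map (pairSquare (w.count true))]
  · refine Nat.card_congr (Equiv.subtypeEquivRight fun t => ?_)
    rw [mem_rookPlacements]
    simp only [IsNonAttacking, Finset.card_map, Finset.forall_mem_map, Finset.subset_iff,
      pairEdge_mem_edgeSet, ne_eq, (pairEdge _).injective.eq_iff,
      (pairSquare _).injective.eq_iff]
    have hmem : ∀ p : Fin (w.count true) × Fin (w.count true),
        pairSquare _ p ∈ revBoard w ↔ xsBefore w ((p.1 : ℕ) + 1) < (p.2 : ℕ) + 1 := by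
      intro p
      rw [← mem_revBoard_iff w p.1 p.2 (hw ▸ p.1.2) p.2.2, ← hw]
      rfl
    have hd := fun p q => pairEdge_disjoint_iff (n := w.count true) p q
    have hs := fun p q => pairSquare_coords_ne_iff (n := w.count true) p q
    simp only [ne_eq] at hd hs
    simp only [hmem, hd, hs]
    tauto
  · intro s hs p hp
    have h := revBoard_subset w ((mem_rookPlacements.1 hs).1.1 hp)
    rw [← hw] at h
    simp only [Finset.mem_product, Finset.mem_range] at h
    refine ⟨(⟨w.count true - 1 - p.1, by omega⟩, ⟨w.count true - 1 - p.2, by omega⟩), ?_⟩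
    ext <;> simp only [pairSquare_apply] <;> omega
  · exact fun s hs e he => mem_range_pairEdge (hs.2.1 e he)

theorem IsNormalOrder.exists_wordOp_eq_sum {w : List Bool} {S : ℤ → ℝ} (hS : IsNormalOrder w S)
    (m : ℕ) : ∃ N, m ≤ N ∧ (∀ k : ℤ, (N : ℤ) ≤ k → S k = 0) ∧
      wordOp w = ∑ k ∈ Finset.range N, S k • (xOp ^ k * dOp ^ k) := by
  obtain ⟨hfin, hneg, hop⟩ := hS
  obtain ⟨M, hM⟩ := hfin.bddAbove
  have hzero : ∀ k : ℤ, ((max m (M.toNat + 1) : ℕ) : ℤ) ≤ k → S k = 0 := by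
    intro k hk
    by_contra hne
    have := hM (Function.mem_support.2 hne)
    omega
  refine ⟨max m (M.toNat + 1), le_max_left _ _, hzero, ?_⟩
  rw [hop, finsum_eq_sum_of_support_subset (s := (Finset.range _).map Nat.castEmbedding),
    Finset.sum_map]
  · refine Finset.sum_congr rfl fun k _ => ?_
    simp [xkDk]
    rfl
  · intro k hk
    have hSk : S k ≠ 0 := fun h => hk (by simp [h])
    have h0 : 0 ≤ k := not_lt.1 fun h => hSk (hneg k h)
    have h1 := not_le.1 fun h => hSk (hzero k h)
    simp only [Finset.coe_map, Set.mem_image, Finset.mem_coe, Finset.mem_range,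
      Nat.castEmbedding_apply]
    exact ⟨k.toNat, by omega, by omega⟩

/-- For a Dyck word `w` with `n` `x`'s, the normal order coefficient `S_w(k)` equals
`m_{n-k}(Γ_w)`, the number of matchings of size `n - k` in the bipartite graph `Γ_w`. -/
theorem normalOrder_eq_matchCount (w : List Bool) (hw : IsDyck w) (n : ℕ)
    (hn : w.count true = n) (S : ℤ → ℝ) (hS : IsNormalOrder w S) (k : ℤ) :
    S k = if 0 ≤ (n : ℤ) - k then (matchCount (bipGraph w) ((n : ℤ) - k).toNat : ℝ)
      else 0 := by
  have hn' : w.count false = n := hw.1 ▸ hn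
  rw [matchCount_bipGraph w hw.1]
  rcases lt_or_ge k 0 with hk | hk
  · rw [hS.2.1 k hk, wordRook_eq_zero (Or.inl (by omega))]
    simp
  lift k to ℕ using hk
  obtain ⟨N, hN, hzero, hop⟩ := hS.exists_wordOp_eq_sum (n + 1)
  have hrook : wordOp w = ∑ j ∈ Finset.range N,
      (if j ≤ n then (wordRook w (n - j) : ℝ) else 0) • (xOp ^ j * dOp ^ j) := by
    rw [wordOp_eq_sum, hn, hn', ← Finset.sum_range_reflect,
      ← Finset.sum_subset (Finset.range_mono hN)]
    · refine Finset.sum_congr rfl fun j hj => ?_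
      have hj' : j ≤ n := Nat.lt_succ_iff.1 (Finset.mem_range.1 hj)
      rw [if_pos hj', Nat.add_sub_cancel, Nat.sub_sub_self hj']
    · intro j _ hj
      rw [if_neg (by simpa using hj), zero_smul]
  rcases lt_or_ge k N with hkN | hkN
  · rw [coeff_eq_of_sum_eq (c := fun j : ℕ => S j) (hop.symm.trans hrook) k hkN]
    refine if_congr (by omega) ?_ rfl
    congr 2
    omega
  · rw [hzero k (by omega), if_neg (by omega)]
end
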